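/- arXiv:2206.01984 — 4 statements merged into one kernel-verified Lean document; each statement's English description precedes it below -/
import Mathlib

section
/- Let E be a real normed vector space. Suppose that for all u, w ∈ E, every map γ : [0,1] → E with γ(0) = u, γ(1) = w and dist(γ(α), γ(β)) = |α − β| · dist(u, w) for all α, β ∈ [0,1] satisfies γ(α) = (1−α)·u + α·w for all α ∈ [0,1]. Then E is strictly convex (StrictConvexSpace ℝ E). That is, a normed vector space is uniquely geodesic only if its unit ball is strictly convex. -/
open Set

/-- If two unit vectors satisfy `‖x + y‖ = 2`, the norm is additive on the cone they span. -/
theorem norm_smul_add_smul_of_norm_add_eq_two {E : Type*} [NormedAddCommGroup E]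
    [NormedSpace ℝ E] {x y : E} (hx : ‖x‖ = 1) (hy : ‖y‖ = 1) (hxy : ‖x + y‖ = 2)
    {a b : ℝ} (ha : 0 ≤ a) (hb : 0 ≤ b) : ‖a • x + b • y‖ = a + b := by
  wlog hab : a ≤ b generalizing x y a b
  · rw [add_comm, add_comm a]
    exact this hy hx (by rwa [add_comm]) hb ha (le_of_not_ge hab)
  apply le_antisymm
  · simpa [norm_smul, hx, hy, abs_of_nonneg ha, abs_of_nonneg hb] using
      norm_add_le (a • x) (b • y)
  · have h := norm_sub_norm_le (b • (x + y)) ((b - a) • x)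
    rw [show b • (x + y) - (b - a) • x = a • x + b • y by module, norm_smul, norm_smul, hx, hxy,
      Real.norm_of_nonneg hb, Real.norm_of_nonneg (sub_nonneg.2 hab)] at h
    linarith

/-- If a real normed vector space is uniquely geodesic (every constant-speed geodesic
between two points is the linear interpolation), then it is strictly convex. -/
theorem uniquely_geodesic_strictConvexSpace
    {E : Type*} [NormedAddCommGroup E] [NormedSpace ℝ E]
    (huniq : ∀ u w : E, ∀ γ : ℝ → E, γ 0 = u → γ 1 = w →
      (∀ α ∈ Icc (0 : ℝ) 1, ∀ β ∈ Icc (0 : ℝ) 1,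
        dist (γ α) (γ β) = |α - β| * dist u w) →
      ∀ α ∈ Icc (0 : ℝ) 1, γ α = (1 - α) • u + α • w) :
    StrictConvexSpace ℝ E := by
  refine StrictConvexSpace.of_norm_add_ne_two fun x y hx hy hne hxy => hne ?_
  let f : ℝ → ℝ := fun t => min (2 * t) 1
  let g : ℝ → ℝ := fun t => max (2 * t - 1) 0
  have hf : Monotone f := fun s t h => by dsimp only [f]; gcongr
  have hg : Monotone g := fun s t h => by dsimp only [g]; gcongr
  have hfg (t : ℝ) : f t + g t = 2 * t := by
    dsimp only [f, g]
    grind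
  have hdist {s t : ℝ} (h : s ≤ t) : dist (f t • x + g t • y) (f s • x + g s • y) =
      2 * (t - s) := by
    rw [dist_eq_norm, show f t • x + g t • y - (f s • x + g s • y) =
      (f t - f s) • x + (g t - g s) • y by module,
      norm_smul_add_smul_of_norm_add_eq_two hx hy hxy (sub_nonneg.2 (hf h))
        (sub_nonneg.2 (hg h))]
    linarith [hfg t, hfg s]
  have key := huniq 0 (x + y) (fun t => f t • x + g t • y) (by simp [f, g])
    (by norm_num [f, g]) (fun α _ β _ => by
      rw [dist_zero_left, hxy]
      rcases le_total α β with h | h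
      · rw [dist_comm, hdist h, abs_of_nonpos (sub_nonpos.2 h)]
        ring
      · rw [hdist h, abs_of_nonneg (sub_nonneg.2 h)]
        ring) (1 / 2) (by norm_num)
  have hmid : x = (1 / 2 : ℝ) • (x + y) := by simpa [f, g] using key
  calc x = (2 : ℝ) • x - x := by module
    _ = (2 : ℝ) • ((1 / 2 : ℝ) • (x + y)) - x := by rw [← hmid]
    _ = y := by module
end

section
/- Let μ₀ be a Borel probability measure on ℝ and let T : ℝ → ℝ be nondecreasing. Then for every Borel measurable S : ℝ → ℝ with S♯μ₀ = T♯μ₀, one has ∫⁻ ENNReal.ofReal((x − T x)²) dμ₀(x) ≤ ∫⁻ ENNReal.ofReal((x − S x)²) dμ₀(x). That is, the nondecreasing transport map pushing μ₀ onto a given measure minimizes the quadratic (Wasserstein-2) transport cost among all transport maps. -/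
open MeasureTheory

/-- If `P` and `Q` are either disjoint or cover the space, then `P ∩ Q` has the least possible
measure among the intersections of `P` with sets of the same measure as `Q`. -/
lemma measure_inter_le_of_disjoint_or_compl_subset {α : Type*} [MeasurableSpace α]
    (μ : Measure α) [IsFiniteMeasure μ] {P Q R : Set α} (hP : MeasurableSet P)
    (hQR : μ Q = μ R) (h : Disjoint P Q ∨ Pᶜ ⊆ Q) : μ (P ∩ Q) ≤ μ (P ∩ R) := by
  rcases h with h | h
  · simp [h.inter_eq]
  · have hQ : μ (P ∩ Q) + μ Pᶜ = μ Q := by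
      rw [← measure_inter_add_sdiff Q hP, Set.inter_comm, Set.sdiff_eq,
        Set.inter_eq_self_of_subset_right h]
    have hR : μ R ≤ μ (P ∩ R) + μ Pᶜ := by
      rw [← measure_inter_add_sdiff R hP, Set.inter_comm]
      gcongr
      exact fun _ hx => hx.2
    rw [← hQR, ← hQ] at hR
    exact (ENNReal.add_le_add_iff_right (measure_ne_top μ _)).1 hR

/-- The quadratic cost is the area of the square with side the interval between the points. -/
lemma ofReal_sub_sq_eq_volume_prod_uIoc (x y : ℝ) :
    ENNReal.ofReal ((x - y) ^ 2) =
      (volume : Measure (ℝ × ℝ)) (Set.uIoc x y ×ˢ Set.uIoc x y) := by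
  rw [Measure.volume_eq_prod, Measure.prod_prod, Real.volume_uIoc,
    ← ENNReal.ofReal_mul (abs_nonneg _), abs_mul_abs_self]
  congr 1
  ring

/-- Layer-cake formula for the quadratic transport cost. -/
lemma lintegral_ofReal_sub_sq_eq (μ : Measure ℝ) [SFinite μ] {f : ℝ → ℝ} (hf : Measurable f) :
    ∫⁻ x, ENNReal.ofReal ((x - f x) ^ 2) ∂μ =
      ∫⁻ p : ℝ × ℝ, (μ (Set.Iio (min p.1 p.2) ∩ f ⁻¹' Set.Ici (max p.1 p.2)) +
        μ (Set.Ici (max p.1 p.2) ∩ f ⁻¹' Set.Iio (min p.1 p.2))) := by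
  have hE : MeasurableSet {q : ℝ × ℝ × ℝ |
      q.2 ∈ Set.uIoc q.1 (f q.1) ×ˢ Set.uIoc q.1 (f q.1)} := by
    simp only [Set.mem_prod, Set.mem_uIoc]
    measurability
  simp_rw [ofReal_sub_sq_eq_volume_prod_uIoc]
  refine (Measure.prod_apply (μ := μ) (ν := volume) hE).symm.trans ?_
  rw [Measure.prod_apply_symm hE]
  refine lintegral_congr fun p => ?_
  rw [← measure_union _ (measurableSet_Ici.inter (hf measurableSet_Iio))]
  · congr 1
    ext x
    simp only [Set.mem_preimage, Set.mem_ofPred_eq, Set.mem_prod, Set.mem_uIoc, Set.mem_union,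
      Set.mem_inter_iff, Set.mem_Iio, Set.mem_Ici, lt_min_iff, max_le_iff]
    grind
  · refine Set.disjoint_left.2 fun x hx hx' => ?_
    have h₁ : x < min p.1 p.2 := hx.1
    have h₂ : max p.1 p.2 ≤ x := hx'.1
    exact absurd (h₁.trans_le (min_le_max.trans h₂)) (lt_irrefl x)

/-- The nondecreasing transport map pushing `μ₀` onto a given measure minimizes the
quadratic (Wasserstein-2) transport cost among all transport maps. -/
theorem monotone_map_minimizes_quadratic_cost
    (μ₀ : Measure ℝ) [IsProbabilityMeasure μ₀]
    (T : ℝ → ℝ) (hT : Monotone T)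
    (S : ℝ → ℝ) (hSmeas : Measurable S) (hpush : μ₀.map S = μ₀.map T) :
    ∫⁻ x, ENNReal.ofReal ((x - T x) ^ 2) ∂μ₀ ≤
      ∫⁻ x, ENNReal.ofReal ((x - S x) ^ 2) ∂μ₀ := by
  have hpre {A : Set ℝ} (hA : MeasurableSet A) : μ₀ (T ⁻¹' A) = μ₀ (S ⁻¹' A) := by
    rw [← Measure.map_apply hT.measurable hA, ← Measure.map_apply hSmeas hA, hpush]
  rw [lintegral_ofReal_sub_sq_eq μ₀ hT.measurable, lintegral_ofReal_sub_sq_eq μ₀ hSmeas]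
  refine lintegral_mono fun p => add_le_add ?_ ?_
  · refine measure_inter_le_of_disjoint_or_compl_subset μ₀ measurableSet_Iio
      (hpre measurableSet_Ici) (or_iff_not_imp_left.2 fun h y hy => ?_)
    obtain ⟨x, hx, hTx⟩ := Set.not_disjoint_iff.1 h
    exact le_trans hTx (hT (hx.le.trans (not_lt.1 hy)))
  · refine measure_inter_le_of_disjoint_or_compl_subset μ₀ measurableSet_Ici
      (hpre measurableSet_Iio) (or_iff_not_imp_left.2 fun h y hy => ?_)
    obtain ⟨x, hx, hTx⟩ := Set.not_disjoint_iff.1 h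
    exact lt_of_le_of_lt (hT ((not_le.1 (mt Set.mem_Ici.2 hy)).le.trans hx)) hTx
end

section
/- Let μ be a Borel probability measure on ℝ, F := cdf μ, and define the quantile function F†(p) := sInf {t : p ≤ F(t)}. Then the pushforward of Lebesgue measure restricted to the open unit interval under F† equals μ: Measure.map F† (volume.restrict (Set.Ioo 0 1)) = μ. -/
open MeasureTheory ProbabilityTheory

/-- The quantile function and the cumulative distribution function form a Galois connection
on the open unit interval. -/
theorem sInf_le_cdf_le_iff (μ : Measure ℝ) {p : ℝ} (hp : p ∈ Set.Ioo (0 : ℝ) 1) (t : ℝ) :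
    sInf {s : ℝ | p ≤ cdf μ s} ≤ t ↔ p ≤ cdf μ t := by
  have hne : {s : ℝ | p ≤ cdf μ s}.Nonempty :=
    (((tendsto_cdf_atTop μ).eventually (eventually_gt_nhds hp.2)).exists).imp fun _ h => h.le
  have hbdd : BddBelow {s : ℝ | p ≤ cdf μ s} := by
    obtain ⟨b, hb⟩ := ((tendsto_cdf_atBot μ).eventually (eventually_lt_nhds hp.1)).exists
    refine ⟨b, fun s hs => ?_⟩
    by_contra! h
    exact absurd (hs.trans (monotone_cdf μ h.le)) hb.not_ge
  refine ⟨fun h => ?_, fun h => csInf_le hbdd h⟩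
  have hright : Filter.Tendsto (cdf μ) (nhdsWithin t (Set.Ioi t)) (nhds (cdf μ t)) :=
    ((cdf μ).right_continuous t).tendsto.mono_left (nhdsWithin_mono t Set.Ioi_subset_Ici_self)
  refine ge_of_tendsto hright ?_
  filter_upwards [self_mem_nhdsWithin] with s hs
  obtain ⟨u, hu, hus⟩ := exists_lt_of_csInf_lt hne (h.trans_lt hs)
  exact le_trans hu (monotone_cdf μ hus.le)

/-- The pushforward of Lebesgue measure on the open unit interval under the quantile
function `F†` of a Borel probability measure `μ` on `ℝ` equals `μ`. -/
theorem quantile_map_uniform_eq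
    (μ : Measure ℝ) [IsProbabilityMeasure μ]
    (Fdag : ℝ → ℝ) (hFdag : ∀ p, Fdag p = sInf {t : ℝ | p ≤ cdf μ t}) :
    Measure.map Fdag (volume.restrict (Set.Ioo (0 : ℝ) 1)) = μ := by
  have gc : ∀ p ∈ Set.Ioo (0 : ℝ) 1, ∀ t, Fdag p ≤ t ↔ p ≤ cdf μ t := fun p hp t => by
    rw [hFdag, sInf_le_cdf_le_iff μ hp]
  have hmono : MonotoneOn Fdag (Set.Ioo (0 : ℝ) 1) := fun p hp q hq hpq =>
    (gc p hp _).2 (hpq.trans ((gc q hq _).1 le_rfl))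
  have hmeas : AEMeasurable Fdag (volume.restrict (Set.Ioo (0 : ℝ) 1)) :=
    aemeasurable_restrict_of_monotoneOn measurableSet_Ioo hmono
  refine (Measure.ext_of_Iic _ _ fun t => ?_).symm
  have hpre : Fdag ⁻¹' Set.Iic t =ᵐ[volume.restrict (Set.Ioo (0 : ℝ) 1)] Set.Iic (cdf μ t) := by
    filter_upwards [ae_restrict_mem measurableSet_Ioo] with p hp
    exact propext (gc p hp t)
  rw [Measure.map_apply_of_aemeasurable hmeas measurableSet_Iic, measure_congr hpre,
    Measure.restrict_apply measurableSet_Iic, ← ofReal_cdf]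
  apply le_antisymm
  · calc ENNReal.ofReal (cdf μ t) = volume (Set.Ioo 0 (cdf μ t)) := by simp
      _ ≤ volume (Set.Iic (cdf μ t) ∩ Set.Ioo 0 1) := measure_mono fun p hp =>
        ⟨hp.2.le, hp.1, hp.2.trans_le (cdf_le_one μ t)⟩
  · calc volume (Set.Iic (cdf μ t) ∩ Set.Ioo 0 1)
      _ ≤ volume (Set.Ioc 0 (cdf μ t)) := measure_mono fun p hp => ⟨hp.2.1, hp.1⟩
      _ = ENNReal.ofReal (cdf μ t) := by simp
end

section
/- Let μ₀ be a Borel probability measure on ℝ and T₁, T₂ : ℝ → ℝ nondecreasing maps, and set μ₁ := T₁♯μ₀ and μ₂ := T₂♯μ₀. Then for every Borel measurable S : ℝ → ℝ with S♯μ₁ = μ₂, one has ∫⁻ ENNReal.ofReal((T₁ x − T₂ x)²) dμ₀(x) ≤ ∫⁻ ENNReal.ofReal((x − S x)²) dμ₁(x). That is, the L²(μ₀) distance between the transport maps (the CDT embedding distance) is a lower bound for the quadratic cost of any transport map between the two measures, which underlies the isometric embedding property d_{W²}(s₁, s₂) = ‖s₁* − s₂*‖_{L²(s₀)} of the cumulative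 distribution transform. -/
open MeasureTheory

/-- The area of the triangle `x ≤ a ≤ b < y`. -/
theorem volume_triangle (x y : ℝ) :
    volume {p : ℝ × ℝ | x ≤ p.1 ∧ p.1 ≤ p.2 ∧ p.2 < y} =
      ENNReal.ofReal ((max (y - x) 0) ^ 2 / 2) := by
  have hE : MeasurableSet {p : ℝ × ℝ | x ≤ p.1 ∧ p.1 ≤ p.2 ∧ p.2 < y} :=
    (measurableSet_le measurable_const measurable_fst).inter
      ((measurableSet_le measurable_fst measurable_snd).inter
        (measurableSet_lt measurable_snd measurable_const))
  rw [Measure.volume_eq_prod, Measure.prod_apply hE]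
  rcases le_total y x with h | h
  · rw [max_eq_right (by linarith)]
    simp only [ne_eq, OfNat.ofNat_ne_zero, not_false_eq_true, zero_pow, zero_div,
      ENNReal.ofReal_zero]
    refine (lintegral_congr fun a => ?_).trans lintegral_zero
    rw [show Prod.mk a ⁻¹' {p : ℝ × ℝ | x ≤ p.1 ∧ p.1 ≤ p.2 ∧ p.2 < y} = ∅ from ?_]
    · simp
    · ext b
      simp only [Set.mem_preimage, Set.mem_ofPred_eq, Set.mem_empty_iff_false, iff_false]
      rintro ⟨h₁, h₂, h₃⟩
      linarith
  · rw [max_eq_left (by linarith)]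
    have hsection (a : ℝ) :
        volume (Prod.mk a ⁻¹' {p : ℝ × ℝ | x ≤ p.1 ∧ p.1 ≤ p.2 ∧ p.2 < y}) =
          (Set.Icc x y).indicator (fun a => ENNReal.ofReal (y - a)) a := by
      have hset : Prod.mk a ⁻¹' {p : ℝ × ℝ | x ≤ p.1 ∧ p.1 ≤ p.2 ∧ p.2 < y} =
          {b | x ≤ a ∧ b ∈ Set.Ico a y} := by
        ext b; simp
      rw [hset]
      by_cases hxa : x ≤ a
      · simp only [hxa, true_and, Set.ofPred_mem_eq, Real.volume_Ico]
        rcases le_or_gt a y with hay | hay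
        · simp [Set.indicator, hxa, hay]
        · simp [Set.indicator, hxa, hay.not_ge, hay.le]
      · simp [Set.indicator, hxa]
    simp_rw [hsection]
    rw [lintegral_indicator measurableSet_Icc, ← ofReal_integral_eq_lintegral_ofReal]
    · rw [integral_Icc_eq_integral_Ioc, ← intervalIntegral.integral_of_le h]
      simp [intervalIntegral.integral_comp_sub_left (fun t : ℝ => t)]
    · exact Continuous.integrableOn_Icc (by fun_prop)
    · filter_upwards [ae_restrict_mem measurableSet_Icc] with a ha
      exact sub_nonneg.2 ha.2

/-- Layer-cake formula for the squared positive part of a difference. -/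
theorem lintegral_sq_posPart_sub {Ω : Type*} [MeasurableSpace Ω] (μ : Measure Ω) [SFinite μ]
    {X Y : Ω → ℝ} (hX : Measurable X) (hY : Measurable Y) :
    ∫⁻ ω, ENNReal.ofReal ((max (Y ω - X ω) 0) ^ 2 / 2) ∂μ =
      ∫⁻ p : ℝ × ℝ, μ {ω | X ω ≤ p.1 ∧ p.1 ≤ p.2 ∧ p.2 < Y ω} := by
  have hE : MeasurableSet
      {q : Ω × (ℝ × ℝ) | X q.1 ≤ q.2.1 ∧ q.2.1 ≤ q.2.2 ∧ q.2.2 < Y q.1} :=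
    (measurableSet_le (hX.comp measurable_fst) measurable_snd.fst).inter
      ((measurableSet_le measurable_snd.fst measurable_snd.snd).inter
        (measurableSet_lt measurable_snd.snd (hY.comp measurable_fst)))
  simp_rw [← volume_triangle]
  exact (Measure.prod_apply hE).symm.trans (Measure.prod_apply_symm hE)

/-- Among all couplings of two laws on `ℝ`, a comonotone one minimizes the expected squared
positive part of the difference. -/
theorem lintegral_sq_posPart_sub_le_of_monotone {Ω α : Type*} [MeasurableSpace Ω]
    [MeasurableSpace α] [LinearOrder α] {μ : Measure Ω} {ν : Measure α} [IsFiniteMeasure μ]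
    [SFinite ν] {T₁ T₂ : α → ℝ} {X Y : Ω → ℝ} (hT₁ : Monotone T₁) (hT₂ : Monotone T₂)
    (hmT₁ : Measurable T₁) (hmT₂ : Measurable T₂) (hX : Measurable X) (hY : Measurable Y)
    (h₁ : μ.map X = ν.map T₁) (h₂ : μ.map Y = ν.map T₂) :
    ∫⁻ t, ENNReal.ofReal ((max (T₂ t - T₁ t) 0) ^ 2 / 2) ∂ν ≤
      ∫⁻ ω, ENNReal.ofReal ((max (Y ω - X ω) 0) ^ 2 / 2) ∂μ := by
  rw [lintegral_sq_posPart_sub ν hmT₁ hmT₂, lintegral_sq_posPart_sub μ hX hY]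
  refine lintegral_mono fun ⟨a, b⟩ => ?_
  by_cases hab : a ≤ b
  swap
  · simp [hab]
  simp only [hab, true_and]
  have hA : ν {t | T₁ t ≤ a} = μ {ω | X ω ≤ a} := by
    have := congrArg (fun m : Measure ℝ => m (Set.Iic a)) h₁
    simpa [Measure.map_apply, hX, hmT₁, Set.preimage] using this.symm
  have hB : ν {t | T₂ t ≤ b} = μ {ω | Y ω ≤ b} := by
    have := congrArg (fun m : Measure ℝ => m (Set.Iic b)) h₂
    simpa [Measure.map_apply, hY, hmT₂, Set.preimage] using this.symm
  have hdiffν : {t | T₁ t ≤ a ∧ b < T₂ t} = {t | T₁ t ≤ a} \ {t | T₂ t ≤ b} := by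
    ext t; simp
  have hdiffμ : {ω | X ω ≤ a ∧ b < Y ω} = {ω | X ω ≤ a} \ {ω | Y ω ≤ b} := by
    ext ω; simp
  rw [hdiffν, hdiffμ]
  have hL₁ : IsLowerSet {t | T₁ t ≤ a} := fun s t hts hs => (hT₁ hts).trans hs
  have hL₂ : IsLowerSet {t | T₂ t ≤ b} := fun s t hts hs => (hT₂ hts).trans hs
  rcases hL₁.total hL₂ with h | h
  · simp [Set.sdiff_eq_empty.2 h]
  · rw [measure_sdiff h (measurableSet_le hmT₂ measurable_const).nullMeasurableSet
      (by rw [hB]; exact measure_ne_top _ _), hA, hB]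
    exact le_measure_sdiff

theorem ofReal_sub_sq_eq_posPart (x y : ℝ) :
    ENNReal.ofReal ((x - y) ^ 2) =
      2 * (ENNReal.ofReal ((max (y - x) 0) ^ 2 / 2) +
        ENNReal.ofReal ((max (x - y) 0) ^ 2 / 2)) := by
  rw [← ENNReal.ofReal_add (by positivity) (by positivity),
    ← ENNReal.ofReal_ofNat 2, ← ENNReal.ofReal_mul (by norm_num)]
  congr 1
  rcases le_total x y with h | h
  · rw [max_eq_left (sub_nonneg.2 h), max_eq_right (sub_nonpos.2 h)]; ring
  · rw [max_eq_left (sub_nonneg.2 h), max_eq_right (sub_nonpos.2 h)]; ring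

theorem lintegral_sub_sq_eq_posPart {Ω : Type*} [MeasurableSpace Ω] (μ : Measure Ω)
    {X Y : Ω → ℝ} (hX : Measurable X) (hY : Measurable Y) :
    ∫⁻ ω, ENNReal.ofReal ((X ω - Y ω) ^ 2) ∂μ =
      2 * (∫⁻ ω, ENNReal.ofReal ((max (Y ω - X ω) 0) ^ 2 / 2) ∂μ +
        ∫⁻ ω, ENNReal.ofReal ((max (X ω - Y ω) 0) ^ 2 / 2) ∂μ) := by
  simp_rw [ofReal_sub_sq_eq_posPart]
  rw [lintegral_const_mul _ (by fun_prop), lintegral_add_left (by fun_prop)]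

/-- The `L²(μ₀)` distance between the nondecreasing transport maps (the CDT embedding
distance) is a lower bound for the quadratic cost of any transport map between the
two pushforward measures. -/
theorem cdt_embedding_lower_bound
    (μ₀ : Measure ℝ) [IsProbabilityMeasure μ₀]
    (T₁ T₂ : ℝ → ℝ) (hT₁ : Monotone T₁) (hT₂ : Monotone T₂)
    (μ₁ μ₂ : Measure ℝ) (hμ₁ : μ₁ = μ₀.map T₁) (hμ₂ : μ₂ = μ₀.map T₂)
    (S : ℝ → ℝ) (hSmeas : Measurable S) (hpush : μ₁.map S = μ₂) :
    ∫⁻ x, ENNReal.ofReal ((T₁ x - T₂ x) ^ 2) ∂μ₀ ≤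
      ∫⁻ x, ENNReal.ofReal ((x - S x) ^ 2) ∂μ₁ := by
  have hm₁ := hT₁.measurable
  have hm₂ := hT₂.measurable
  have : IsFiniteMeasure μ₁ := by rw [hμ₁]; infer_instance
  have h₁ : μ₁.map (fun x => x) = μ₀.map T₁ := Measure.map_id'.trans hμ₁
  have h₂ : μ₁.map S = μ₀.map T₂ := hpush.trans hμ₂
  rw [lintegral_sub_sq_eq_posPart μ₀ hm₁ hm₂,
    lintegral_sub_sq_eq_posPart μ₁ measurable_id' hSmeas]
  gcongr 2 * (?_ + ?_)
  · exact lintegral_sq_posPart_sub_le_of_monotone hT₁ hT₂ hm₁ hm₂ measurable_id' hSmeas h₁ h₂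
  · exact lintegral_sq_posPart_sub_le_of_monotone hT₂ hT₁ hm₂ hm₁ hSmeas measurable_id' h₂ h₁
end
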